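/- The total weight of perfect matchings of G□K₂ equals Σ_{S⊆V} c^{2|S|}·PM(S)²; that is, Z_n = Σ_{S⊆V} c^{2|S|}·PM(S)². -/

import Mathlib

open scoped Classical

/-- `M` is a matching of `G`: a finite set of edges of `G` that are pairwise vertex-disjoint. -/
def IsMatchingSet {α : Type*} (G : SimpleGraph α) (M : Finset (Sym2 α)) : Prop :=
  (∀ e ∈ M, e ∈ G.edgeSet) ∧ ∀ e ∈ M, ∀ f ∈ M, e ≠ f → ∀ v, v ∈ e → v ∉ f

/-- The set of vertices covered by a set of edges `M`. -/
noncomputable def coveredBy {α : Type*} [Fintype α] (M : Finset (Sym2 α)) : Finset α :=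
  Finset.univ.filter fun v => ∃ e ∈ M, v ∈ e

/-- `PMcount G S` is the number of perfect matchings of the induced subgraph `G[S]`,
i.e. the number of matchings of `G` covering exactly the vertex set `S`. -/
noncomputable def PMcount {α : Type*} [Fintype α] (G : SimpleGraph α) (S : Finset α) : ℕ :=
  (Finset.univ.filter fun M : Finset (Sym2 α) => IsMatchingSet G M ∧ coveredBy M = S).card

/-- The weight of a set of edges `M` of `G □ K₂`: `c ^ (2t)` where `t` is the number of
copy edges (edges lying within one of the two copies of `G`) in `M`. -/
noncomputable def wK2 {V : Type*} (c : ℝ) (M : Finset (Sym2 (V × Fin 2))) : ℝ :=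
  c ^ (2 * (M.filter fun e => (Sym2.map Prod.snd e).IsDiag).card)

/-- `Zk G c k` is the total weight of the `k`-edge matchings of `G □ K₂`,
where copy edges have weight `c ^ 2` and rung edges have weight `1`. -/
noncomputable def Zk {V : Type*} [Fintype V] (G : SimpleGraph V) (c : ℝ) (k : ℕ) : ℝ :=
  ∑ M ∈ Finset.univ.filter (fun M : Finset (Sym2 (V × Fin 2)) =>
      IsMatchingSet (G.boxProd (⊤ : SimpleGraph (Fin 2))) M ∧ M.card = k), wK2 c M

lemma coveredBy_eq_biUnion {α : Type*} [Fintype α] (M : Finset (Sym2 α)) :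
    coveredBy M = M.biUnion Sym2.toFinset := by
  ext v
  simp [coveredBy]

lemma mem_coveredBy {α : Type*} [Fintype α] {M : Finset (Sym2 α)} {v : α} :
    v ∈ coveredBy M ↔ ∃ e ∈ M, v ∈ e := by
  simp [coveredBy]

lemma IsMatchingSet.card_coveredBy {α : Type*} [Fintype α] {G : SimpleGraph α}
    {M : Finset (Sym2 α)} (hM : IsMatchingSet G M) : (coveredBy M).card = 2 * M.card := by
  rw [coveredBy_eq_biUnion, Finset.card_biUnion]
  · rw [Finset.sum_congr rfl fun e he =>
      Sym2.card_toFinset_of_not_isDiag e (G.not_isDiag_of_mem_edgeSet (hM.1 e he))]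
    simp [mul_comm]
  · intro e he f hf hef
    rw [Function.onFun, Finset.disjoint_left]
    intro v hv hv'
    rw [Sym2.mem_toFinset] at hv hv'
    exact hM.2 e he f hf hef v hv hv'

lemma IsMatchingSet.eq_of_mem {α : Type*} {G : SimpleGraph α} {M : Finset (Sym2 α)}
    (hM : IsMatchingSet G M) {e f : Sym2 α} (he : e ∈ M) (hf : f ∈ M) {v : α}
    (hve : v ∈ e) (hvf : v ∈ f) : e = f := by
  by_contra h
  exact hM.2 e he f hf h v hve hvf

/-- The rung edge of `G □ K₂` at the vertex `v`. -/
def rung {V : Type*} (v : V) : Sym2 (V × Fin 2) := s((v, 0), (v, 1))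

/-- The copy in layer `l` of the edge `e`. -/
def copyEdge {V : Type*} (l : Fin 2) (e : Sym2 V) : Sym2 (V × Fin 2) := e.map fun v => (v, l)

section

variable {V : Type*}

lemma mem_rung {v : V} {x : V × Fin 2} : x ∈ rung v ↔ x.1 = v := by
  obtain ⟨w, k⟩ := x
  fin_cases k <;> simp [rung]

lemma mem_copyEdge {l : Fin 2} {e : Sym2 V} {x : V × Fin 2} :
    x ∈ copyEdge l e ↔ x.1 ∈ e ∧ x.2 = l := by
  obtain ⟨w, k⟩ := x
  simp only [copyEdge, Sym2.mem_map, Prod.mk.injEq]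
  grind

lemma rung_injective : Function.Injective (rung : V → _) := by
  intro v w h
  have : (v, (0 : Fin 2)) ∈ rung w := h ▸ mem_rung.2 rfl
  exact mem_rung.1 this

lemma copyEdge_injective (l : Fin 2) : Function.Injective (copyEdge l : Sym2 V → _) :=
  Sym2.map.injective fun _ _ h => congrArg Prod.fst h

lemma copyEdge_inj {l k : Fin 2} {e f : Sym2 V} :
    copyEdge l e = copyEdge k f ↔ l = k ∧ e = f := by
  refine ⟨fun h => ?_, fun ⟨h₁, h₂⟩ => h₁ ▸ h₂ ▸ rfl⟩
  have hlk : l = k := by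
    obtain ⟨v, hv⟩ : ∃ v, v ∈ e := ⟨_, e.out_fst_mem⟩
    have : (v, l) ∈ copyEdge k f := h ▸ mem_copyEdge.2 ⟨hv, rfl⟩
    exact (mem_copyEdge.1 this).2
  subst hlk
  exact ⟨rfl, copyEdge_injective l h⟩

lemma isDiag_map_snd_copyEdge (l : Fin 2) (e : Sym2 V) :
    (Sym2.map Prod.snd (copyEdge l e)).IsDiag := by
  induction e with | _ a b => simp [copyEdge]

lemma not_isDiag_map_snd_rung (v : V) : ¬ (Sym2.map Prod.snd (rung v)).IsDiag := by
  simp [rung]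

lemma copyEdge_ne_rung (l : Fin 2) (e : Sym2 V) (v : V) : copyEdge l e ≠ rung v := fun h =>
  not_isDiag_map_snd_rung v (h ▸ isDiag_map_snd_copyEdge l e)

lemma copyEdge_mem_edgeSet {G : SimpleGraph V} {l : Fin 2} {e : Sym2 V} :
    copyEdge l e ∈ (G.boxProd (⊤ : SimpleGraph (Fin 2))).edgeSet ↔ e ∈ G.edgeSet := by
  induction e with | _ a b => simp [copyEdge, SimpleGraph.boxProd_adj]

lemma rung_mem_edgeSet (G : SimpleGraph V) (v : V) :
    rung v ∈ (G.boxProd (⊤ : SimpleGraph (Fin 2))).edgeSet := by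
  simp [rung, SimpleGraph.boxProd_adj]

lemma eq_rung_or_copyEdge {G : SimpleGraph V} {e : Sym2 (V × Fin 2)}
    (he : e ∈ (G.boxProd (⊤ : SimpleGraph (Fin 2))).edgeSet) :
    (∃ v, e = rung v) ∨ ∃ l a, e = copyEdge l a := by
  induction e with | _ x y =>
  obtain ⟨v, k⟩ := x
  obtain ⟨w, l⟩ := y
  simp only [SimpleGraph.mem_edgeSet, SimpleGraph.boxProd_adj, SimpleGraph.top_adj] at he
  obtain ⟨-, rfl⟩ | ⟨hkl, rfl⟩ := he
  · exact .inr ⟨k, s(v, w), rfl⟩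
  · refine .inl ⟨v, ?_⟩
    fin_cases k <;> fin_cases l <;> simp_all [rung, Sym2.eq_swap]

variable [Fintype V]

/-- The edges of `G` whose copy in layer `l` belongs to `M`. -/
noncomputable def layer (M : Finset (Sym2 (V × Fin 2))) (l : Fin 2) : Finset (Sym2 V) :=
  Finset.univ.filter fun e => copyEdge l e ∈ M

/-- The vertices of `G` whose rung does not belong to `M`. -/
noncomputable def rungless (M : Finset (Sym2 (V × Fin 2))) : Finset V :=
  Finset.univ.filter fun v => rung v ∉ M

/-- The edge set formed by `F l` in each layer `l` together with the rungs outside `S`. -/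
noncomputable def glue (S : Finset V) (F : Fin 2 → Finset (Sym2 V)) :
    Finset (Sym2 (V × Fin 2)) :=
  Finset.univ.filter fun e => (∃ v, v ∉ S ∧ e = rung v) ∨ ∃ l, ∃ a ∈ F l, e = copyEdge l a

lemma mem_layer {M : Finset (Sym2 (V × Fin 2))} {l : Fin 2} {e : Sym2 V} :
    e ∈ layer M l ↔ copyEdge l e ∈ M := by
  simp [layer]

lemma mem_rungless {M : Finset (Sym2 (V × Fin 2))} {v : V} :
    v ∈ rungless M ↔ rung v ∉ M := by
  simp [rungless]

lemma mem_glue {S : Finset V} {F : Fin 2 → Finset (Sym2 V)} {e : Sym2 (V × Fin 2)} :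
    e ∈ glue S F ↔ (∃ v, v ∉ S ∧ e = rung v) ∨ ∃ l, ∃ a ∈ F l, e = copyEdge l a := by
  simp [glue]

lemma rung_mem_glue {S : Finset V} {F : Fin 2 → Finset (Sym2 V)} {v : V} :
    rung v ∈ glue S F ↔ v ∉ S := by
  simp [mem_glue, rung_injective.eq_iff, (copyEdge_ne_rung _ _ _).symm]

lemma copyEdge_mem_glue {S : Finset V} {F : Fin 2 → Finset (Sym2 V)} {l : Fin 2} {e : Sym2 V} :
    copyEdge l e ∈ glue S F ↔ e ∈ F l := by
  simp only [mem_glue, copyEdge_ne_rung, and_false, exists_false, false_or, copyEdge_inj]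
  grind

lemma layer_glue (S : Finset V) (F : Fin 2 → Finset (Sym2 V)) : layer (glue S F) = F := by
  ext l e
  rw [mem_layer, copyEdge_mem_glue]

lemma rungless_glue (S : Finset V) (F : Fin 2 → Finset (Sym2 V)) : rungless (glue S F) = S := by
  ext v
  rw [mem_rungless, rung_mem_glue, not_not]

lemma glue_rungless_layer {G : SimpleGraph V} {M : Finset (Sym2 (V × Fin 2))}
    (hM : IsMatchingSet (G.boxProd (⊤ : SimpleGraph (Fin 2))) M) :
    glue (rungless M) (layer M) = M := by
  ext e
  constructor
  · intro he
    obtain ⟨v, hv, rfl⟩ | ⟨l, a, ha, rfl⟩ := mem_glue.1 he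
    · rwa [mem_rungless, not_not] at hv
    · exact mem_layer.1 ha
  · intro he
    obtain ⟨v, rfl⟩ | ⟨l, a, rfl⟩ := eq_rung_or_copyEdge (hM.1 e he)
    · rwa [rung_mem_glue, mem_rungless, not_not]
    · rwa [copyEdge_mem_glue, mem_layer]

lemma IsMatchingSet.layer {G : SimpleGraph V} {M : Finset (Sym2 (V × Fin 2))}
    (hM : IsMatchingSet (G.boxProd (⊤ : SimpleGraph (Fin 2))) M) (l : Fin 2) :
    IsMatchingSet G (layer M l) := by
  refine ⟨fun e he => copyEdge_mem_edgeSet.1 (hM.1 _ (mem_layer.1 he)), ?_⟩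
  intro e he f hf hef v hve hvf
  exact hef (copyEdge_injective l (hM.eq_of_mem (mem_layer.1 he) (mem_layer.1 hf)
    (v := (v, l)) (mem_copyEdge.2 ⟨hve, rfl⟩) (mem_copyEdge.2 ⟨hvf, rfl⟩)))

lemma IsMatchingSet.coveredBy_eq_univ {G : SimpleGraph V} {M : Finset (Sym2 (V × Fin 2))}
    (hM : IsMatchingSet (G.boxProd (⊤ : SimpleGraph (Fin 2))) M) :
    coveredBy M = Finset.univ ↔ M.card = Fintype.card V := by
  rw [← Finset.card_eq_iff_eq_univ, hM.card_coveredBy, Fintype.card_prod, Fintype.card_fin]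
  omega

lemma IsMatchingSet.coveredBy_layer {G : SimpleGraph V} {M : Finset (Sym2 (V × Fin 2))}
    (hM : IsMatchingSet (G.boxProd (⊤ : SimpleGraph (Fin 2))) M)
    (hcard : M.card = Fintype.card V) (l : Fin 2) :
    coveredBy (_root_.layer M l) = rungless M := by
  ext v
  rw [mem_coveredBy, mem_rungless]
  constructor
  · rintro ⟨e, he, hve⟩ hv
    exact copyEdge_ne_rung l e v (hM.eq_of_mem (mem_layer.1 he) hv
      (v := (v, l)) (mem_copyEdge.2 ⟨hve, rfl⟩) (mem_rung.2 rfl))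
  · intro hv
    obtain ⟨e, he, hve⟩ := mem_coveredBy.1
      (hM.coveredBy_eq_univ.2 hcard ▸ Finset.mem_univ (v, l))
    obtain ⟨w, rfl⟩ | ⟨k, a, rfl⟩ := eq_rung_or_copyEdge (hM.1 e he)
    · obtain rfl : v = w := mem_rung.1 hve
      exact absurd he hv
    · obtain ⟨hva, rfl⟩ := mem_copyEdge.1 hve
      exact ⟨a, mem_layer.2 he, hva⟩

lemma isMatchingSet_glue {G : SimpleGraph V} {S : Finset V} {F : Fin 2 → Finset (Sym2 V)}
    (hF : ∀ l, IsMatchingSet G (F l)) (hS : ∀ l, coveredBy (F l) = S) :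
    IsMatchingSet (G.boxProd (⊤ : SimpleGraph (Fin 2))) (glue S F) := by
  have hmem : ∀ {l a v}, a ∈ F l → v ∈ a → v ∈ S := fun {l a v} ha hv =>
    hS l ▸ mem_coveredBy.2 ⟨a, ha, hv⟩
  constructor
  · intro e he
    obtain ⟨v, -, rfl⟩ | ⟨l, a, ha, rfl⟩ := mem_glue.1 he
    · exact rung_mem_edgeSet G v
    · exact copyEdge_mem_edgeSet.2 ((hF l).1 a ha)
  · intro e he f hf hef x hxe hxf
    apply hef
    obtain ⟨v, hv, rfl⟩ | ⟨l, a, ha, rfl⟩ := mem_glue.1 he <;>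
      obtain ⟨w, hw, rfl⟩ | ⟨k, b, hb, rfl⟩ := mem_glue.1 hf <;>
      simp only [mem_rung, mem_copyEdge] at hxe hxf
    · rw [← hxe, ← hxf]
    · exact absurd (hmem hb hxf.1) (hxe ▸ hv)
    · exact absurd (hmem ha hxe.1) (hxf ▸ hw)
    · obtain rfl : l = k := hxe.2.symm.trans hxf.2
      rw [(hF l).eq_of_mem ha hb hxe.1 hxf.1]

lemma coveredBy_glue {S : Finset V} {F : Fin 2 → Finset (Sym2 V)}
    (hS : ∀ l, coveredBy (F l) = S) : coveredBy (glue S F) = Finset.univ := by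
  rw [Finset.eq_univ_iff_forall]
  rintro ⟨v, l⟩
  rw [mem_coveredBy]
  by_cases hv : v ∈ S
  · obtain ⟨a, ha, hva⟩ := mem_coveredBy.1 ((hS l).symm ▸ hv)
    exact ⟨copyEdge l a, copyEdge_mem_glue.2 ha, mem_copyEdge.2 ⟨hva, rfl⟩⟩
  · exact ⟨rung v, rung_mem_glue.2 hv, mem_rung.2 rfl⟩

lemma IsMatchingSet.wK2_eq {G : SimpleGraph V} {M : Finset (Sym2 (V × Fin 2))}
    (hM : IsMatchingSet (G.boxProd (⊤ : SimpleGraph (Fin 2))) M)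
    (hcard : M.card = Fintype.card V) (c : ℝ) :
    wK2 c M = c ^ (2 * (rungless M).card) := by
  have hrungs : (M.filter fun e => ¬ (Sym2.map Prod.snd e).IsDiag) =
      (rungless M)ᶜ.image rung := by
    ext e
    simp only [Finset.mem_filter, Finset.mem_image, Finset.mem_compl, mem_rungless, not_not]
    constructor
    · rintro ⟨he, hdiag⟩
      obtain ⟨v, rfl⟩ | ⟨l, a, rfl⟩ := eq_rung_or_copyEdge (hM.1 e he)
      · exact ⟨v, he, rfl⟩
      · exact absurd (isDiag_map_snd_copyEdge l a) hdiag
    · rintro ⟨v, hv, rfl⟩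
      exact ⟨hv, not_isDiag_map_snd_rung v⟩
  have hsplit := M.card_filter_add_card_filter_not fun e => (Sym2.map Prod.snd e).IsDiag
  rw [hrungs, Finset.card_image_of_injective _ rung_injective, hcard,
    ← Finset.card_add_card_compl (rungless M)] at hsplit
  rw [wK2, Nat.add_right_cancel hsplit]

end

/-- The total weight of perfect matchings of `G □ K₂` (i.e. of matchings with `n = |V|`
edges, since `G □ K₂` has `2n` vertices) equals `Σ_{S ⊆ V} c^{2|S|} · PM(S)²`. -/
theorem stmt1 {V : Type*} [Fintype V] (G : SimpleGraph V) (c : ℝ) (hc : 0 < c) :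
    Zk G c (Fintype.card V) =
      ∑ S ∈ (Finset.univ : Finset V).powerset,
        c ^ (2 * S.card) * (PMcount G S : ℝ) ^ 2 := by
  rw [Zk, ← Finset.sum_fiberwise_of_maps_to (g := rungless)
    fun M _ => Finset.mem_powerset.2 (Finset.subset_univ _)]
  refine Finset.sum_congr rfl fun S _ => ?_
  have hsq : (PMcount G S : ℝ) ^ 2 = ((Fintype.piFinset fun _ : Fin 2 =>
      Finset.univ.filter fun M : Finset (Sym2 V) =>
        IsMatchingSet G M ∧ coveredBy M = S).card : ℝ) := by
    rw [Fintype.card_piFinset_const, Nat.cast_pow, PMcount]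
  rw [hsq, mul_comm, ← nsmul_eq_mul, ← Finset.sum_const]
  refine Finset.sum_nbij' layer (glue S) ?_ ?_ ?_ ?_ ?_
  · intro M hM
    simp only [Finset.mem_filter, Finset.mem_univ, true_and] at hM
    obtain ⟨⟨hM, hcard⟩, rfl⟩ := hM
    simpa [Fintype.mem_piFinset, -Fin.forall_fin_two] using
      fun l => ⟨hM.layer l, hM.coveredBy_layer hcard l⟩
  · intro F hF
    simp only [Fintype.mem_piFinset, Finset.mem_filter, Finset.mem_univ, true_and] at hF ⊢
    have hglue := isMatchingSet_glue (fun l => (hF l).1) fun l => (hF l).2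
    exact ⟨⟨hglue, hglue.coveredBy_eq_univ.1 (coveredBy_glue fun l => (hF l).2)⟩,
      rungless_glue S F⟩
  · intro M hM
    simp only [Finset.mem_filter, Finset.mem_univ, true_and] at hM
    obtain ⟨⟨hM, -⟩, rfl⟩ := hM
    exact glue_rungless_layer hM
  · exact fun F _ => layer_glue S F
  · intro M hM
    simp only [Finset.mem_filter, Finset.mem_univ, true_and] at hM
    obtain ⟨⟨hM, hcard⟩, rfl⟩ := hM
    exact hM.wK2_eq hcard c
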